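/- The dynamic programming operator T is a contraction with modulus ρ in the weighted sup-norm: for all functions V, V' : X → ℝ, ‖T V − T V'‖ ≤ ρ ‖V − V'‖. -/

import Mathlib

noncomputable section
open Finset Real Filter Topology Matrix

variable {abar sbar : ℕ}

/-- Unit vector `1_{a,s}` of coordinate `i = (a,s)`. -/
def e (i : Fin abar × Fin sbar) : Fin abar × Fin sbar → ℤ := fun j => if j = i then 1 else 0

/-- The state space `X = {x : 0 ≤ x ≤ x̄}` (componentwise). -/
def Xset (xbar : Fin abar × Fin sbar → ℤ) : Finset (Fin abar × Fin sbar → ℤ) :=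
  Finset.Icc 0 xbar

/-- The price set `D`. -/
def Dset (dlow dbar : ℝ) : Set (Fin abar × Fin sbar → ℝ) :=
  {d | ∀ i, dlow ≤ d i ∧ d i ≤ dbar}

/-- Multinomial logit choice probability `Π_{a,s}(d)`. -/
def mnl (βc βd : ℝ) (β : Fin sbar → ℝ) (d : Fin abar × Fin sbar → ℝ)
    (a : Fin abar) (s : Fin sbar) : ℝ :=
  Real.exp (βc + β s + βd * d (a, s)) /
    ((∑ k, Real.exp (βc + β k + βd * d (a, k))) + 1)

/-- No-purchase probability `Π_{a,0}(d)`. -/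
def mnl0 (βc βd : ℝ) (β : Fin sbar → ℝ) (d : Fin abar × Fin sbar → ℝ) (a : Fin abar) : ℝ :=
  1 / ((∑ k, Real.exp (βc + β k + βd * d (a, k))) + 1)

/-- Purchase probability `p_{a,s}(d) = λ pr(a) Π_{a,s}(d)`. -/
def prob (lam : ℝ) (pr : Fin abar → ℝ) (βc βd : ℝ) (β : Fin sbar → ℝ)
    (d : Fin abar × Fin sbar → ℝ) (i : Fin abar × Fin sbar) : ℝ :=
  lam * pr i.1 * mnl βc βd β d i.1 i.2

/-- The pairs `(a,s)` that are feasible at `x`, i.e. such that `x + 1_{a,s} ∈ X`. -/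
def feas (xbar : Fin abar × Fin sbar → ℤ) (x : Fin abar × Fin sbar → ℤ) :
    Finset (Fin abar × Fin sbar) :=
  Finset.univ.filter fun i => x + e i ∈ Xset xbar

/-- Objective of the dynamic-programming maximisation. -/
def obj (xbar : Fin abar × Fin sbar → ℤ) (lam : ℝ) (pr : Fin abar → ℝ) (βc βd : ℝ)
    (β : Fin sbar → ℝ) (r : ℝ) (V : (Fin abar × Fin sbar → ℤ) → ℝ)
    (x : Fin abar × Fin sbar → ℤ) (d : Fin abar × Fin sbar → ℝ) : ℝ :=
  (∑ i ∈ feas xbar x, prob lam pr βc βd β d i * (r + d i + V (x + e i) - V x)) + V x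

/-- The dynamic programming operator `T`. -/
def T (xbar : Fin abar × Fin sbar → ℤ) (dlow dbar lam : ℝ) (pr : Fin abar → ℝ)
    (βc βd : ℝ) (β : Fin sbar → ℝ) (r : ℝ)
    (V : (Fin abar × Fin sbar → ℤ) → ℝ) : (Fin abar × Fin sbar → ℤ) → ℝ :=
  fun x => sSup {v | ∃ d ∈ Dset (abar := abar) (sbar := sbar) dlow dbar,
    v = obj xbar lam pr βc βd β r V x d}

/-- Transition probabilities `P_{x,y}(d)`. -/
def Ptrans (xbar : Fin abar × Fin sbar → ℤ) (lam : ℝ) (pr : Fin abar → ℝ) (βc βd : ℝ)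
    (β : Fin sbar → ℝ) (x y : Fin abar × Fin sbar → ℤ)
    (d : Fin abar × Fin sbar → ℝ) : ℝ :=
  (if y = x then 1 - ∑ i ∈ feas xbar x, prob lam pr βc βd β d i else 0) +
    ∑ i ∈ feas xbar x, if y = x + e i then prob lam pr βc βd β d i else 0

/-- `max_{d ∈ D} Σ_{y ∈ X} P_{x,y}(d) v(y)`. -/
def mstep (xbar : Fin abar × Fin sbar → ℤ) (dlow dbar lam : ℝ) (pr : Fin abar → ℝ)
    (βc βd : ℝ) (β : Fin sbar → ℝ) (v : (Fin abar × Fin sbar → ℤ) → ℝ)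
    (x : Fin abar × Fin sbar → ℤ) : ℝ :=
  sSup {w | ∃ d ∈ Dset (abar := abar) (sbar := sbar) dlow dbar,
    w = ∑ y ∈ Xset xbar, Ptrans xbar lam pr βc βd β x y d * v y}

/-- `v` solves the auxiliary dynamic program. -/
def AuxDP (xbar : Fin abar × Fin sbar → ℤ) (dlow dbar lam : ℝ) (pr : Fin abar → ℝ)
    (βc βd : ℝ) (β : Fin sbar → ℝ) (v : (Fin abar × Fin sbar → ℤ) → ℝ) : Prop :=
  v xbar = 1 ∧ ∀ x ∈ Xset xbar, x ≠ xbar →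
    v x = 1 + mstep xbar dlow dbar lam pr βc βd β v x

/-- The modulus of contraction `ρ`. -/
def rho (xbar : Fin abar × Fin sbar → ℤ) (dlow dbar lam : ℝ) (pr : Fin abar → ℝ)
    (βc βd : ℝ) (β : Fin sbar → ℝ) (v : (Fin abar × Fin sbar → ℤ) → ℝ) : ℝ :=
  sSup {w | ∃ x ∈ Xset xbar, w = mstep xbar dlow dbar lam pr βc βd β v x / v x}

/-- Weighted sup-norm `‖V‖ = max_{x ∈ X} |V(x)| / v(x)`. -/
def wnorm (xbar : Fin abar × Fin sbar → ℤ) (v V : (Fin abar × Fin sbar → ℤ) → ℝ) : ℝ :=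
  sSup {w | ∃ x ∈ Xset xbar, w = |V x| / v x}

/-- The candidate fixed point `V*(x) = (d̄ + r) Σ (x̄ - x) - c₀`. -/
def Vstar (xbar : Fin abar × Fin sbar → ℤ) (dbar r c0 : ℝ) :
    (Fin abar × Fin sbar → ℤ) → ℝ :=
  fun x => (dbar + r) * ∑ i, ((xbar i - x i : ℤ) : ℝ) - c0

/-- Concave extensibility of `f` on a set `Y` of integer points. -/
def ConcExt (Y : Set (Fin abar × Fin sbar → ℤ)) (f : (Fin abar × Fin sbar → ℤ) → ℝ) : Prop :=
  ∀ x ∈ Y, ∀ Q : Finset (Fin abar × Fin sbar → ℤ), ↑Q ⊆ Y →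
    ∀ μ : (Fin abar × Fin sbar → ℤ) → ℝ,
      (∀ q ∈ Q, 0 ≤ μ q) → ∑ q ∈ Q, μ q = 1 →
      (∀ i, (x i : ℝ) = ∑ q ∈ Q, μ q * (q i : ℝ)) →
      ∑ q ∈ Q, μ q * f q ≤ f x

/-- Joint concave extensibility of `g` on a set `Y` of mixed integer/real points. -/
def ConcExt2 (Y : Set ((Fin abar × Fin sbar → ℤ) × (Fin abar × Fin sbar → ℝ)))
    (g : (Fin abar × Fin sbar → ℤ) → (Fin abar × Fin sbar → ℝ) → ℝ) : Prop :=
  ∀ z ∈ Y, ∀ Q : Finset ((Fin abar × Fin sbar → ℤ) × (Fin abar × Fin sbar → ℝ)), ↑Q ⊆ Y →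
    ∀ μ : ((Fin abar × Fin sbar → ℤ) × (Fin abar × Fin sbar → ℝ)) → ℝ,
      (∀ q ∈ Q, 0 ≤ μ q) → ∑ q ∈ Q, μ q = 1 →
      (∀ i, (z.1 i : ℝ) = ∑ q ∈ Q, μ q * (q.1 i : ℝ)) →
      (∀ i, z.2 i = ∑ q ∈ Q, μ q * q.2 i) →
      ∑ q ∈ Q, μ q * g q.1 q.2 ≤ g z.1 z.2

/-- The set `P = {p(d) : d ∈ D}` of purchase-probability vectors. -/
def Pset (dlow dbar lam : ℝ) (pr : Fin abar → ℝ) (βc βd : ℝ) (β : Fin sbar → ℝ) :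
    Set (Fin abar × Fin sbar → ℝ) :=
  {p | ∃ d ∈ Dset (abar := abar) (sbar := sbar) dlow dbar,
    p = fun i => prob lam pr βc βd β d i}

/-- The expected continuation value `g(x,p)`. -/
def gfun (xbar : Fin abar × Fin sbar → ℤ) (V : (Fin abar × Fin sbar → ℤ) → ℝ)
    (x : Fin abar × Fin sbar → ℤ) (p : Fin abar × Fin sbar → ℝ) : ℝ :=
  (∑ i ∈ feas xbar x, p i * (V (x + e i) - V x)) + V x

lemma mnl_nonneg (βc βd : ℝ) (β : Fin sbar → ℝ) (d : Fin abar × Fin sbar → ℝ)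
    (a : Fin abar) (s : Fin sbar) : 0 ≤ mnl βc βd β d a s := by
  unfold mnl
  positivity

lemma sum_mnl_le_one (βc βd : ℝ) (β : Fin sbar → ℝ) (d : Fin abar × Fin sbar → ℝ)
    (a : Fin abar) : ∑ s, mnl βc βd β d a s ≤ 1 := by
  unfold mnl
  rw [← Finset.sum_div, div_le_one (by positivity)]
  linarith

lemma prob_nonneg {lam : ℝ} (hlam : 0 ≤ lam) {pr : Fin abar → ℝ} (hpr : ∀ a, 0 ≤ pr a)
    (βc βd : ℝ) (β : Fin sbar → ℝ) (d : Fin abar × Fin sbar → ℝ) (i : Fin abar × Fin sbar) :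
    0 ≤ prob lam pr βc βd β d i :=
  mul_nonneg (mul_nonneg hlam (hpr _)) (mnl_nonneg ..)

lemma sum_prob_le_one {lam : ℝ} (hlam : 0 ≤ lam) (hlam1 : lam ≤ 1) {pr : Fin abar → ℝ}
    (hpr : ∀ a, 0 ≤ pr a) (hprs : ∑ a, pr a = 1) (βc βd : ℝ) (β : Fin sbar → ℝ)
    (d : Fin abar × Fin sbar → ℝ) (F : Finset (Fin abar × Fin sbar)) :
    ∑ i ∈ F, prob lam pr βc βd β d i ≤ 1 := by
  calc ∑ i ∈ F, prob lam pr βc βd β d i ≤ ∑ i, prob lam pr βc βd β d i :=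
        Finset.sum_le_sum_of_subset_of_nonneg (Finset.subset_univ _)
          fun i _ _ => prob_nonneg hlam hpr βc βd β d i
    _ = ∑ a, lam * pr a * ∑ s, mnl βc βd β d a s := by
        simp only [Fintype.sum_prod_type, prob, Finset.mul_sum]
    _ ≤ ∑ a, lam * pr a :=
        Finset.sum_le_sum fun a _ =>
          mul_le_of_le_one_right (mul_nonneg hlam (hpr a)) (sum_mnl_le_one βc βd β d a)
    _ ≤ 1 := by rw [← Finset.mul_sum, hprs, mul_one]; exact hlam1

/-- Expected value of `V` after one transition from `x`, as a sum over the feasible pairs. -/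
lemma sum_Ptrans_mul {xbar x : Fin abar × Fin sbar → ℤ} (hx : x ∈ Xset xbar) (lam : ℝ)
    (pr : Fin abar → ℝ) (βc βd : ℝ) (β : Fin sbar → ℝ) (V : (Fin abar × Fin sbar → ℤ) → ℝ)
    (d : Fin abar × Fin sbar → ℝ) :
    ∑ y ∈ Xset xbar, Ptrans xbar lam pr βc βd β x y d * V y =
      ∑ i ∈ feas xbar x, prob lam pr βc βd β d i * V (x + e i) +
        (1 - ∑ i ∈ feas xbar x, prob lam pr βc βd β d i) * V x := by
  simp only [Ptrans, add_mul, Finset.sum_add_distrib, Finset.sum_mul, ite_mul, zero_mul]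
  rw [Finset.sum_ite_eq' (Xset xbar) x, if_pos hx, Finset.sum_comm, add_comm]
  congr 1
  · refine Finset.sum_congr rfl fun i hi => ?_
    rw [Finset.sum_ite_eq', if_pos (Finset.mem_filter.1 hi).2]

lemma obj_eq {xbar x : Fin abar × Fin sbar → ℤ} (hx : x ∈ Xset xbar) (lam : ℝ)
    (pr : Fin abar → ℝ) (βc βd : ℝ) (β : Fin sbar → ℝ) (r : ℝ)
    (V : (Fin abar × Fin sbar → ℤ) → ℝ) (d : Fin abar × Fin sbar → ℝ) :
    obj xbar lam pr βc βd β r V x d =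
      ∑ i ∈ feas xbar x, prob lam pr βc βd β d i * (r + d i) +
        ∑ y ∈ Xset xbar, Ptrans xbar lam pr βc βd β x y d * V y := by
  rw [sum_Ptrans_mul hx, obj, sub_mul, one_mul, Finset.sum_mul]
  have h : ∑ i ∈ feas xbar x, prob lam pr βc βd β d i * (r + d i + V (x + e i) - V x) =
      ∑ i ∈ feas xbar x, prob lam pr βc βd β d i * (r + d i) +
        ∑ i ∈ feas xbar x, prob lam pr βc βd β d i * V (x + e i) -
        ∑ i ∈ feas xbar x, prob lam pr βc βd β d i * V x := by
    rw [← Finset.sum_add_distrib, ← Finset.sum_sub_distrib]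
    exact Finset.sum_congr rfl fun i _ => by ring
  rw [h]
  ring

lemma Ptrans_nonneg {lam : ℝ} (hlam : 0 ≤ lam) (hlam1 : lam ≤ 1) {pr : Fin abar → ℝ}
    (hpr : ∀ a, 0 ≤ pr a) (hprs : ∑ a, pr a = 1) (xbar : Fin abar × Fin sbar → ℤ)
    (βc βd : ℝ) (β : Fin sbar → ℝ) (x y : Fin abar × Fin sbar → ℤ)
    (d : Fin abar × Fin sbar → ℝ) : 0 ≤ Ptrans xbar lam pr βc βd β x y d := by
  have h := sum_prob_le_one hlam hlam1 hpr hprs βc βd β d (feas xbar x)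
  refine add_nonneg ?_ (Finset.sum_nonneg fun i _ => ?_)
  · split_ifs <;> linarith
  · split_ifs
    exacts [prob_nonneg hlam hpr βc βd β d i, le_rfl]

lemma sum_Ptrans {xbar x : Fin abar × Fin sbar → ℤ} (hx : x ∈ Xset xbar) (lam : ℝ)
    (pr : Fin abar → ℝ) (βc βd : ℝ) (β : Fin sbar → ℝ) (d : Fin abar × Fin sbar → ℝ) :
    ∑ y ∈ Xset xbar, Ptrans xbar lam pr βc βd β x y d = 1 := by
  simpa using sum_Ptrans_mul hx lam pr βc βd β (fun _ => 1) d

lemma Ptrans_le_one {lam : ℝ} (hlam : 0 ≤ lam) (hlam1 : lam ≤ 1) {pr : Fin abar → ℝ}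
    (hpr : ∀ a, 0 ≤ pr a) (hprs : ∑ a, pr a = 1) {xbar x y : Fin abar × Fin sbar → ℤ}
    (hx : x ∈ Xset xbar) (hy : y ∈ Xset xbar) (βc βd : ℝ) (β : Fin sbar → ℝ)
    (d : Fin abar × Fin sbar → ℝ) : Ptrans xbar lam pr βc βd β x y d ≤ 1 :=
  (Finset.single_le_sum (f := fun y => Ptrans xbar lam pr βc βd β x y d)
    (fun y _ => Ptrans_nonneg hlam hlam1 hpr hprs xbar βc βd β x y d) hy).trans_eq
    (sum_Ptrans hx lam pr βc βd β d)

lemma mul_le_of_abs_le {p a b : ℝ} (hp : 0 ≤ p) (hp1 : p ≤ 1) (h : |a| ≤ b) : p * a ≤ b :=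
  calc p * a ≤ p * b := mul_le_mul_of_nonneg_left ((le_abs_self a).trans h) hp
    _ ≤ b := mul_le_of_le_one_left ((abs_nonneg a).trans h) hp1

lemma sum_Ptrans_mul_le {lam : ℝ} (hlam : 0 ≤ lam) (hlam1 : lam ≤ 1) {pr : Fin abar → ℝ}
    (hpr : ∀ a, 0 ≤ pr a) (hprs : ∑ a, pr a = 1) {xbar x : Fin abar × Fin sbar → ℤ}
    (hx : x ∈ Xset xbar) (βc βd : ℝ) (β : Fin sbar → ℝ)
    (V : (Fin abar × Fin sbar → ℤ) → ℝ) (d : Fin abar × Fin sbar → ℝ) :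
    ∑ y ∈ Xset xbar, Ptrans xbar lam pr βc βd β x y d * V y ≤ ∑ y ∈ Xset xbar, |V y| :=
  Finset.sum_le_sum fun y hy => mul_le_of_abs_le
    (Ptrans_nonneg hlam hlam1 hpr hprs xbar βc βd β x y d)
    (Ptrans_le_one hlam hlam1 hpr hprs hx hy βc βd β d) le_rfl

lemma sum_Ptrans_mul_le_mstep {lam : ℝ} (hlam : 0 ≤ lam) (hlam1 : lam ≤ 1) {pr : Fin abar → ℝ}
    (hpr : ∀ a, 0 ≤ pr a) (hprs : ∑ a, pr a = 1) {xbar x : Fin abar × Fin sbar → ℤ}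
    (hx : x ∈ Xset xbar) {dlow dbar : ℝ} (βc βd : ℝ) (β : Fin sbar → ℝ)
    (V : (Fin abar × Fin sbar → ℤ) → ℝ) {d : Fin abar × Fin sbar → ℝ} (hd : d ∈ Dset dlow dbar) :
    ∑ y ∈ Xset xbar, Ptrans xbar lam pr βc βd β x y d * V y ≤
      mstep xbar dlow dbar lam pr βc βd β V x := by
  refine le_csSup ⟨∑ y ∈ Xset xbar, |V y|, ?_⟩ ⟨d, hd, rfl⟩
  rintro _ ⟨d', -, rfl⟩
  exact sum_Ptrans_mul_le hlam hlam1 hpr hprs hx βc βd β V d'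

lemma obj_le_T {lam : ℝ} (hlam : 0 ≤ lam) (hlam1 : lam ≤ 1) {pr : Fin abar → ℝ}
    (hpr : ∀ a, 0 ≤ pr a) (hprs : ∑ a, pr a = 1) {xbar x : Fin abar × Fin sbar → ℤ}
    (hx : x ∈ Xset xbar) {dlow dbar : ℝ} (βc βd : ℝ) (β : Fin sbar → ℝ) (r : ℝ)
    (V : (Fin abar × Fin sbar → ℤ) → ℝ) {d : Fin abar × Fin sbar → ℝ} (hd : d ∈ Dset dlow dbar) :
    obj xbar lam pr βc βd β r V x d ≤ T xbar dlow dbar lam pr βc βd β r V x := by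
  refine le_csSup ⟨∑ _i ∈ feas xbar x, (|r| + max |dlow| |dbar|) + ∑ y ∈ Xset xbar, |V y|, ?_⟩
    ⟨d, hd, rfl⟩
  rintro _ ⟨d', hd', rfl⟩
  rw [obj_eq hx]
  refine add_le_add (Finset.sum_le_sum fun i _ => ?_)
    (sum_Ptrans_mul_le hlam hlam1 hpr hprs hx βc βd β V d')
  refine mul_le_of_abs_le (prob_nonneg hlam hpr βc βd β d' i) ?_ ?_
  · simpa using sum_prob_le_one hlam hlam1 hpr hprs βc βd β d' {i}
  · exact (abs_add_le _ _).trans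
      (add_le_add_right (abs_le_max_abs_abs (hd' i).1 (hd' i).2) _)

lemma AuxDP.pos {lam : ℝ} (hlam : 0 ≤ lam) (hlam1 : lam ≤ 1) {pr : Fin abar → ℝ}
    (hpr : ∀ a, 0 ≤ pr a) (hprs : ∑ a, pr a = 1) {xbar : Fin abar × Fin sbar → ℤ}
    {dlow dbar : ℝ} (hd : dlow ≤ dbar) {βc βd : ℝ} {β : Fin sbar → ℝ}
    {v : (Fin abar × Fin sbar → ℤ) → ℝ} (hv : AuxDP xbar dlow dbar lam pr βc βd β v)
    {x : Fin abar × Fin sbar → ℤ} (hx : x ∈ Xset xbar) : 0 < v x := by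
  induction hn : (∑ i, (xbar i - x i)).toNat using Nat.strong_induction_on generalizing x with
  | _ n ih =>
  by_cases hxb : x = xbar
  · rw [hxb, hv.1]
    exact one_pos
  have hnext : ∀ i ∈ feas xbar x, 0 < v (x + e i) := by
    intro i hi
    have hmem := (Finset.mem_filter.1 hi).2
    refine ih _ ?_ hmem rfl
    have hsum : ∑ j, (xbar j - (x + e i) j) = ∑ j, (xbar j - x j) - 1 := by
      simp [e, Finset.sum_sub_distrib, Finset.sum_add_distrib]
      ring
    have hnonneg : 0 ≤ ∑ j, (xbar j - (x + e i) j) :=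
      Finset.sum_nonneg fun j _ => sub_nonneg.2 ((Finset.mem_Icc.1 hmem).2 j)
    omega
  have hmem : (fun _ => dlow) ∈ Dset (abar := abar) (sbar := sbar) dlow dbar := fun _ => ⟨le_rfl, hd⟩
  have h := sum_Ptrans_mul_le_mstep hlam hlam1 hpr hprs hx βc βd β v hmem
  rw [sum_Ptrans_mul hx] at h
  have hbellman := hv.2 x hx hxb
  have hs := Finset.sum_nonneg fun i (hi : i ∈ feas xbar x) =>
    mul_nonneg (prob_nonneg hlam hpr βc βd β (fun _ => dlow) i) (hnext i hi).le
  have hp := Finset.sum_nonneg fun i (_ : i ∈ feas xbar x) =>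
    prob_nonneg hlam hpr βc βd β (fun _ => dlow) i
  exact pos_of_mul_pos_right (by linarith) hp

lemma le_sSup_finset {α : Type*} (F : Finset α) (f : α → ℝ) {x : α} (hx : x ∈ F) :
    f x ≤ sSup {w | ∃ x ∈ F, w = f x} := by
  refine le_csSup ((F.finite_toSet.image f).subset ?_).bddAbove ⟨x, hx, rfl⟩
  rintro _ ⟨y, hy, rfl⟩
  exact ⟨y, hy, rfl⟩

lemma T_sub_T_le {lam : ℝ} (hlam : 0 ≤ lam) (hlam1 : lam ≤ 1) {pr : Fin abar → ℝ}
    (hpr : ∀ a, 0 ≤ pr a) (hprs : ∑ a, pr a = 1) {xbar x : Fin abar × Fin sbar → ℤ}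
    (hx : x ∈ Xset xbar) {dlow dbar : ℝ} (hd : dlow ≤ dbar) (βc βd : ℝ) (β : Fin sbar → ℝ)
    (r : ℝ) {V V' v : (Fin abar × Fin sbar → ℤ) → ℝ} {M : ℝ} (hM : 0 ≤ M)
    (h : ∀ y ∈ Xset xbar, V y - V' y ≤ M * v y) :
    T xbar dlow dbar lam pr βc βd β r V x - T xbar dlow dbar lam pr βc βd β r V' x ≤
      M * mstep xbar dlow dbar lam pr βc βd β v x := by
  rw [sub_le_iff_le_add]
  refine csSup_le ⟨_, fun _ => dlow, fun _ => ⟨le_rfl, hd⟩, rfl⟩ ?_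
  rintro _ ⟨d, hd', rfl⟩
  have hT := obj_le_T hlam hlam1 hpr hprs hx βc βd β r V' hd'
  have hm := mul_le_mul_of_nonneg_left
    (sum_Ptrans_mul_le_mstep hlam hlam1 hpr hprs hx βc βd β v hd') hM
  rw [obj_eq hx] at hT ⊢
  have hdiff : ∑ y ∈ Xset xbar, Ptrans xbar lam pr βc βd β x y d * V y -
      ∑ y ∈ Xset xbar, Ptrans xbar lam pr βc βd β x y d * V' y ≤
      M * ∑ y ∈ Xset xbar, Ptrans xbar lam pr βc βd β x y d * v y := by
    rw [← Finset.sum_sub_distrib, Finset.mul_sum]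
    refine Finset.sum_le_sum fun y hy => ?_
    have := mul_le_mul_of_nonneg_left (h y hy)
      (Ptrans_nonneg hlam hlam1 hpr hprs xbar βc βd β x y d)
    linarith
  linarith

/-- The DP operator `T` is a contraction with modulus `ρ` in the
weighted sup-norm: `‖T V − T V'‖ ≤ ρ ‖V − V'‖` for all `V, V' : X → ℝ`. -/
theorem T_contraction (abar sbar : ℕ) (xbar : Fin abar × Fin sbar → ℤ) (hxbar : ∀ i, 0 ≤ xbar i)
    (dlow dbar : ℝ) (hd : dlow ≤ dbar) (lam : ℝ) (hlam0 : 0 < lam) (hlam1 : lam < 1)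
    (pr : Fin abar → ℝ) (hpr : ∀ a, 0 ≤ pr a ∧ pr a ≤ 1) (hprs : ∑ a, pr a = 1)
    (βc : ℝ) (β : Fin sbar → ℝ) (βd : ℝ) (hβd : βd < 0) (r : ℝ)
    (vstar : (Fin abar × Fin sbar → ℤ) → ℝ)
    (hvstar : AuxDP xbar dlow dbar lam pr βc βd β vstar) :
    ∀ V V' : (Fin abar × Fin sbar → ℤ) → ℝ,
      wnorm xbar vstar
          (T xbar dlow dbar lam pr βc βd β r V - T xbar dlow dbar lam pr βc βd β r V') ≤
        rho xbar dlow dbar lam pr βc βd β vstar * wnorm xbar vstar (V - V') := by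
  intro V V'
  have hpr0 : ∀ a, 0 ≤ pr a := fun a => (hpr a).1
  have hpos : ∀ {x}, x ∈ Xset xbar → 0 < vstar x := hvstar.pos hlam0.le hlam1.le hpr0 hprs hd
  set M := wnorm xbar vstar (V - V') with hMdef
  have hxbar_mem : xbar ∈ Xset xbar := Finset.mem_Icc.2 ⟨hxbar, le_rfl⟩
  have hbound : ∀ y ∈ Xset xbar, |V y - V' y| ≤ M * vstar y := fun y hy =>
    (div_le_iff₀ (hpos hy)).1
      (le_sSup_finset (Xset xbar) (fun x => |(V - V') x| / vstar x) hy)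
  have hM : 0 ≤ M := nonneg_of_mul_nonneg_left
    ((abs_nonneg _).trans (hbound _ hxbar_mem)) (hpos hxbar_mem)
  refine csSup_le ⟨_, xbar, hxbar_mem, rfl⟩ ?_
  rintro _ ⟨x, hx, rfl⟩
  have hrho := (div_le_iff₀ (hpos hx)).1 (le_sSup_finset (Xset xbar)
    (fun x => mstep xbar dlow dbar lam pr βc βd β vstar x / vstar x) hx)
  change _ ≤ rho xbar dlow dbar lam pr βc βd β vstar * vstar x at hrho
  rw [div_le_iff₀ (hpos hx), Pi.sub_apply]
  calc _ ≤ M * mstep xbar dlow dbar lam pr βc βd β vstar x :=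
        abs_sub_le_iff.2
          ⟨T_sub_T_le hlam0.le hlam1.le hpr0 hprs hx hd βc βd β r hM
            fun y hy => (abs_sub_le_iff.1 (hbound y hy)).1,
          T_sub_T_le hlam0.le hlam1.le hpr0 hprs hx hd βc βd β r hM
            fun y hy => (abs_sub_le_iff.1 (hbound y hy)).2⟩
    _ ≤ M * (rho xbar dlow dbar lam pr βc βd β vstar * vstar x) :=
        mul_le_mul_of_nonneg_left hrho hM
    _ = _ := by ring
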